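/- arXiv:2107.00787 — 2 statements merged into one kernel-verified Lean document; each statement's English description precedes it below -/
import Mathlib

section
/- Let a ≥ 4 be an integer with a ≡ 0 (mod 4). If there exists a rational constant C̃ such that N*(a,0; 8n+a) = C̃ · Ñ(a,0; 8n+a) for all nonnegative integers n, then a ∈ {4, 8}. -/
/-- `N a b n` is the number of tuples `(x₁,…,x_a,y₁,…,y_b) ∈ ℤ^{a+b}` with
`n = x₁² + ⋯ + x_a² + 3y₁² + ⋯ + 3y_b²`. -/
noncomputable def N (a b : ℕ) (n : ℤ) : ℕ :=
  Set.ncard {p : (Fin a → ℤ) × (Fin b → ℤ) |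
    n = ∑ i, (p.1 i) ^ 2 + 3 * ∑ j, (p.2 j) ^ 2}

/-- `Nstar a b n` is the number of such tuples with all coordinates odd. -/
noncomputable def Nstar (a b : ℕ) (n : ℤ) : ℕ :=
  Set.ncard {p : (Fin a → ℤ) × (Fin b → ℤ) |
    (∀ i, Odd (p.1 i)) ∧ (∀ j, Odd (p.2 j)) ∧
    n = ∑ i, (p.1 i) ^ 2 + 3 * ∑ j, (p.2 j) ^ 2}

/-- `Ntilde a b n = N a b n - N a b (n/4)`, where the second term is `0` when `4 ∤ n`. -/
noncomputable def Ntilde (a b : ℕ) (n : ℤ) : ℤ :=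
  (N a b n : ℤ) - (if (4 : ℤ) ∣ n then (N a b (n / 4) : ℤ) else 0)

open Filter Topology HurwitzZeta

/-- The lattice points of `ℤ^d` of squared norm `m`. -/
noncomputable def latticeSphere (d m : ℕ) : Finset (Fin d → ℤ) :=
  (Fintype.piFinset fun _ => Finset.Icc (-(m : ℤ)) m).filter fun x => ∑ i, x i ^ 2 = (m : ℤ)

lemma mem_latticeSphere {d m : ℕ} {x : Fin d → ℤ} :
    x ∈ latticeSphere d m ↔ ∑ i, x i ^ 2 = (m : ℤ) := by
  simp only [latticeSphere, Finset.mem_filter, Fintype.mem_piFinset, Finset.mem_Icc,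
    and_iff_right_iff_imp]
  intro h i
  have hi : x i ^ 2 ≤ (m : ℤ) :=
    h ▸ Finset.single_le_sum (f := fun i => x i ^ 2) (fun j _ => sq_nonneg (x j))
      (Finset.mem_univ i)
  rw [← abs_le]
  nlinarith [sq_abs (x i), abs_nonneg (x i), Int.le_self_sq |x i|]

lemma hasSum_residue_theta (r : ZMod 4) {s : ℝ} (hs : 0 < s) :
    HasSum (fun n : ℤ => if (n : ZMod 4) = r then Real.exp (-(Real.pi / (16 * s)) * (n : ℝ) ^ 2)
      else 0) (√s * cosKernel ((r.val / 4 : ℝ) : UnitAddCircle) s) := by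
  have key := hasSum_int_evenKernel (r.val / 4 : ℝ) (one_div_pos.2 hs)
  rw [evenKernel_functional_equation, ← Real.sqrt_eq_rpow, one_div_one_div, Real.sqrt_div' _ hs.le,
    Real.sqrt_one, one_div_one_div] at key
  have hinj : Function.Injective fun n : ℤ => 4 * n + (r.val : ℤ) := fun m n h => by
    simp only at h; omega
  have h4 : (4 : ZMod 4) = 0 := rfl
  refine (hinj.hasSum_iff ?_).1 (key.congr_fun ?_)
  · intro n hn
    refine if_neg fun h => hn ?_
    subst h
    refine ⟨n / 4, ?_⟩
    simp only [ZMod.val_intCast]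
    push_cast
    exact Int.mul_ediv_add_emod n 4
  · intro n
    simp only [Function.comp_apply]
    rw [if_pos (by push_cast; rw [h4]; simp)]
    congr 1
    push_cast
    field_simp
    ring

lemma hasSum_pi_prod {k : ℕ} {f : Fin k → ℤ → ℝ} {S : Fin k → ℝ} (hf : ∀ i n, 0 ≤ f i n)
    (h : ∀ i, HasSum (f i) (S i)) :
    HasSum (fun x : Fin k → ℤ => ∏ i, f i (x i)) (∏ i, S i) := by
  induction k with
  | zero => simp
  | succ k ih =>
    have h1 := ih (f := fun i => f i.succ) (fun i n => hf _ n) fun i => h i.succ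
    have h0 : 0 ≤ f 0 := hf 0
    have hnn : 0 ≤ fun x : Fin k → ℤ => ∏ i, f i.succ (x i) :=
      fun x => Finset.prod_nonneg fun i _ => hf _ _
    have hs := h1.summable
    have hmul := (h 0).summable.mul_of_nonneg hs h0
    have h2 := (h 0).mul h1 (hmul hnn)
    rw [Fin.prod_univ_succ, ← (Fin.consEquiv fun _ => ℤ).hasSum_iff]
    refine h2.congr_fun fun p => ?_
    simp [Fin.consEquiv, Fin.prod_univ_succ]

lemma hasSum_periodic_theta {d : ℕ} {W : (Fin d → ℤ) → ℝ}
    (hW : ∀ x, W (fun i => ((x i : ZMod 4).val : ℤ)) = W x) {s : ℝ} (hs : 0 < s) :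
    HasSum (fun x : Fin d → ℤ => W x * Real.exp (-(Real.pi / (16 * s)) * ((∑ i, x i ^ 2 : ℤ) : ℝ)))
      (√s ^ d * ∑ r : Fin d → ZMod 4, W (fun i => ((r i).val : ℤ)) *
        ∏ i, cosKernel (((r i).val / 4 : ℝ) : UnitAddCircle) s) := by
  have hr (r : Fin d → ZMod 4) := (hasSum_pi_prod (fun i n => by split_ifs <;> positivity)
      fun i => hasSum_residue_theta (r i) hs).mul_left (W fun i => ((r i).val : ℤ))
  have hval : √s ^ d * ∑ r : Fin d → ZMod 4, W (fun i => ((r i).val : ℤ)) *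
        ∏ i, cosKernel (((r i).val / 4 : ℝ) : UnitAddCircle) s =
      ∑ r : Fin d → ZMod 4, W (fun i => ((r i).val : ℤ)) *
        ∏ i, (√s * cosKernel (((r i).val / 4 : ℝ) : UnitAddCircle) s) := by
    rw [Finset.mul_sum]
    refine Finset.sum_congr rfl fun r _ => ?_
    rw [Finset.prod_mul_distrib, Finset.prod_const, Finset.card_univ, Fintype.card_fin]
    ring
  rw [hval]
  refine (hasSum_sum fun r _ => hr r).congr_fun fun x => ?_
  rw [Finset.sum_eq_single fun i => (x i : ZMod 4)]
  · rw [hW]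
    simp [← Real.exp_sum, Finset.mul_sum]
  · intro r _ hr
    obtain ⟨i, hi⟩ := Function.ne_iff.1 hr
    rw [Finset.prod_eq_zero (Finset.mem_univ i) (if_neg hi.symm), mul_zero]
  · simp

lemma tendsto_pow_mul_prod_cosKernel_sub_one (k : ℕ) {ι : Type*} (t : Finset ι)
    (c : ι → UnitAddCircle) :
    Tendsto (fun s : ℝ => s ^ k * (∏ i ∈ t, cosKernel (c i) s - 1)) atTop (𝓝 0) := by
  classical
  have one (j : ℕ) (c : UnitAddCircle) :
      Tendsto (fun s : ℝ => s ^ j * (cosKernel c s - 1)) atTop (𝓝 0) := by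
    obtain ⟨p, hp, h⟩ := isBigO_atTop_cosKernel_sub c
    refine ((Asymptotics.isBigO_refl (fun s : ℝ => s ^ j) atTop).mul h).trans_tendsto ?_
    simpa using tendsto_rpow_mul_exp_neg_mul_atTop_nhds_zero j p hp
  induction t using Finset.induction_on with
  | empty => simp
  | insert i t hi ih =>
    have h1 : Tendsto (cosKernel (c i)) atTop (𝓝 1) := by
      simpa using (one 0 (c i)).add_const 1
    have := (ih.mul h1).add (one k (c i))
    simp only [zero_mul, add_zero] at this
    refine this.congr fun s => ?_
    rw [Finset.prod_insert hi]
    ring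

/-- A finite combination of products of kernels tending to `1` superpolynomially fast
can only converge after multiplication by a positive power of `s` if the limit is `0`. -/
lemma limit_eq_zero_of_tendsto_pow_mul {ι : Type*} (R : Finset ι) (w : ι → ℝ) (P : ι → ℝ → ℝ)
    (hP : ∀ r k, Tendsto (fun s : ℝ => s ^ k * (P r s - 1)) atTop (𝓝 0)) {k : ℕ} (hk : k ≠ 0)
    {l : ℝ} (h : Tendsto (fun s : ℝ => s ^ k * ∑ r ∈ R, w r * P r s) atTop (𝓝 l)) : l = 0 := by
  have h0 (j : ℕ) : Tendsto (fun s : ℝ => s ^ j * ∑ r ∈ R, w r * (P r s - 1)) atTop (𝓝 0) := by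
    have := tendsto_finsetSum R fun r _ => (hP r j).const_mul (w r)
    simp only [mul_zero, Finset.sum_const_zero] at this
    refine this.congr fun s => ?_
    rw [Finset.mul_sum]
    exact Finset.sum_congr rfl fun r _ => by ring
  have hsplit (s : ℝ) :
      ∑ r ∈ R, w r * P r s = ∑ r ∈ R, w r + ∑ r ∈ R, w r * (P r s - 1) := by
    rw [← Finset.sum_add_distrib]
    exact Finset.sum_congr rfl fun r _ => by ring
  have hpow : Tendsto (fun s : ℝ => (s ^ k)⁻¹) atTop (𝓝 0) :=
    (tendsto_pow_atTop hk).inv_tendsto_atTop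
  have hsum : Tendsto (fun s : ℝ => ∑ r ∈ R, w r * P r s) atTop (𝓝 0) := by
    have := hpow.mul h
    rw [zero_mul] at this
    refine this.congr' ?_
    filter_upwards [eventually_gt_atTop 0] with s hs
    rw [inv_mul_cancel_left₀ (by positivity)]
  have hconst : ∑ r ∈ R, w r = 0 := by
    have := (h0 0).const_add (∑ r ∈ R, w r)
    simp only [pow_zero, one_mul, ← hsplit, add_zero] at this
    exact tendsto_nhds_unique this hsum
  refine tendsto_nhds_unique h ((h0 k).congr fun s => ?_)
  rw [hsplit, hconst, zero_add]

/-- If a `4`-periodic weight on `ℤ^(2k)` sums to zero over all large spheres, it sums to zero over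
the complementary ball. -/
theorem sum_ball_eq_zero_of_sum_spheres_eq_zero {k M : ℕ} (hk : k ≠ 0)
    {W : (Fin (2 * k) → ℤ) → ℝ} (hW : ∀ x, W (fun i => ((x i : ZMod 4).val : ℤ)) = W x)
    (hM : ∀ m, M ≤ m → ∑ x ∈ latticeSphere (2 * k) m, W x = 0) :
    ∑ m ∈ Finset.range M, ∑ x ∈ latticeSphere (2 * k) m, W x = 0 := by
  have hF {s : ℝ} (hs : 0 < s) :
      ∑ m ∈ Finset.range M, Real.exp (-(Real.pi / (16 * s)) * m) *
          ∑ x ∈ latticeSphere (2 * k) m, W x =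
        s ^ k * ∑ r : Fin (2 * k) → ZMod 4, W (fun i => ((r i).val : ℤ)) *
          ∏ i, cosKernel (((r i).val / 4 : ℝ) : UnitAddCircle) s := by
    have h1 := (hasSum_periodic_theta hW hs).tsum_fiberwise fun x => (∑ i, x i ^ 2).toNat
    rw [pow_mul, Real.sq_sqrt hs.le] at h1
    have hfib (m : ℕ) : (fun x : Fin (2 * k) → ℤ => (∑ i, x i ^ 2).toNat) ⁻¹' {m} =
        latticeSphere (2 * k) m := by
      ext x
      have : 0 ≤ ∑ i, x i ^ 2 := Finset.sum_nonneg fun i _ => sq_nonneg _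
      simp only [Set.mem_preimage, Set.mem_singleton_iff, SetLike.mem_coe, mem_latticeSphere]
      omega
    have hterm (m : ℕ) : ∑' x : (fun x : Fin (2 * k) → ℤ => (∑ i, x i ^ 2).toNat) ⁻¹' {m},
        W x * Real.exp (-(Real.pi / (16 * s)) * ((∑ i, (x : Fin (2 * k) → ℤ) i ^ 2 : ℤ) : ℝ)) =
        Real.exp (-(Real.pi / (16 * s)) * m) * ∑ x ∈ latticeSphere (2 * k) m, W x := by
      rw [hfib, Finset.tsum_subtype' (latticeSphere (2 * k) m) fun x =>
        W x * Real.exp (-(Real.pi / (16 * s)) * ((∑ i, x i ^ 2 : ℤ) : ℝ)), Finset.mul_sum]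
      refine Finset.sum_congr rfl fun x hx => ?_
      rw [mem_latticeSphere.1 hx, mul_comm, Int.cast_natCast]
    simp only [hterm] at h1
    refine (hasSum_sum_of_ne_finset_zero fun m hm => ?_).unique h1
    rw [hM m (by simpa using hm), mul_zero]
  refine limit_eq_zero_of_tendsto_pow_mul Finset.univ
    (fun r : Fin (2 * k) → ZMod 4 => W (fun i => ((r i).val : ℤ)))
    (fun r s => ∏ i, cosKernel (((r i).val / 4 : ℝ) : UnitAddCircle) s)
    (fun r j => tendsto_pow_mul_prod_cosKernel_sub_one j Finset.univ
      fun i => (((r i).val / 4 : ℝ) : UnitAddCircle)) hk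
    (Tendsto.congr' (f₁ := fun s : ℝ => ∑ m ∈ Finset.range M,
      Real.exp (-(Real.pi / (16 * s)) * m) * ∑ x ∈ latticeSphere (2 * k) m, W x) ?_ ?_)
  · filter_upwards [eventually_gt_atTop 0] with s hs using hF hs
  · refine tendsto_finsetSum _ fun m _ => ?_
    have h1 : Tendsto (fun s : ℝ => -(Real.pi / (16 * s)) * m) atTop (𝓝 0) := by
      have : Tendsto (fun s : ℝ => 16 * s) atTop atTop :=
        tendsto_id.const_mul_atTop (by norm_num)
      simpa using ((this.const_div_atTop Real.pi).neg).mul_const (m : ℝ)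
    simpa using ((Real.continuous_exp.tendsto 0).comp h1).mul_const _

lemma ncard_prod_fin_zero {d : ℕ} (p : (Fin d → ℤ) → Prop) :
    Set.ncard {q : (Fin d → ℤ) × (Fin 0 → ℤ) | p q.1} = Set.ncard {x | p x} := by
  have : {q : (Fin d → ℤ) × (Fin 0 → ℤ) | p q.1} =
      (Equiv.prodUnique (Fin d → ℤ) (Fin 0 → ℤ)).symm '' {x | p x} := by
    ext q
    simp [Equiv.image_eq_preimage_symm]
  rw [this, Set.ncard_image_of_injective _ (Equiv.injective _)]

lemma N_zero_right (d m : ℕ) : N d 0 m = (latticeSphere d m).card := by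
  have := ncard_prod_fin_zero fun x : Fin d → ℤ => (m : ℤ) = ∑ i, x i ^ 2
  simp only [N, Finset.univ_eq_empty, Finset.sum_empty, mul_zero, add_zero, this]
  rw [← Set.ncard_coe_finset]
  congr 1
  ext x
  simp [mem_latticeSphere, eq_comm]

lemma Nstar_zero_right (d m : ℕ) :
    Nstar d 0 m = ((latticeSphere d m).filter fun x => ∀ i, Odd (x i)).card := by
  have := ncard_prod_fin_zero fun x : Fin d → ℤ => (∀ i, Odd (x i)) ∧ (m : ℤ) = ∑ i, x i ^ 2
  simp only [Nstar, Finset.univ_eq_empty, Finset.sum_empty, mul_zero, add_zero, IsEmpty.forall_iff,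
    true_and, this]
  rw [← Set.ncard_coe_finset]
  congr 1
  ext x
  simp [mem_latticeSphere, eq_comm, and_comm]

/-- Representations with all components even are twice a representation of `m / 4`. -/
lemma card_even_latticeSphere (d m : ℕ) :
    ((latticeSphere d m).filter fun x => ¬ ∃ i, Odd (x i)).card =
      if 4 ∣ m then (latticeSphere d (m / 4)).card else 0 := by
  have hsq (y : Fin d → ℤ) : ∑ i, (2 * y i) ^ 2 = 4 * ∑ i, y i ^ 2 := by
    rw [Finset.mul_sum]
    exact Finset.sum_congr rfl fun i _ => by ring
  have hhalf {x : Fin d → ℤ} (hx : ¬ ∃ i, Odd (x i)) : ∃ y : Fin d → ℤ, x = fun i => 2 * y i := by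
    push Not at hx
    exact ⟨fun i => x i / 2, funext fun i => by have := Int.not_odd_iff_even.1 (hx i); grind⟩
  split_ifs with h
  · symm
    refine Finset.card_bij (fun y _ i => 2 * y i) ?_ ?_ ?_
    · intro y hy
      rw [Finset.mem_filter, mem_latticeSphere, hsq, mem_latticeSphere.1 hy]
      refine ⟨by omega, ?_⟩
      simp
    · intro y _ z _ hyz
      ext i
      have := congrFun hyz i
      omega
    · intro x hx
      rw [Finset.mem_filter, mem_latticeSphere] at hx
      obtain ⟨y, rfl⟩ := hhalf hx.2
      rw [hsq] at hx
      exact ⟨y, mem_latticeSphere.2 (by omega), rfl⟩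
  · rw [Finset.card_eq_zero, Finset.filter_eq_empty_iff]
    intro x hx hx'
    obtain ⟨y, rfl⟩ := hhalf hx'
    rw [mem_latticeSphere, hsq] at hx
    omega

lemma Ntilde_zero_right (d m : ℕ) :
    Ntilde d 0 m = ((latticeSphere d m).filter fun x => ∃ i, Odd (x i)).card := by
  have h1 := card_even_latticeSphere d m
  have h2 := Finset.card_filter_add_card_filter_not (s := latticeSphere d m)
    fun x => ∃ i, Odd (x i)
  have h3 : ((m : ℤ) / 4) = ((m / 4 : ℕ) : ℤ) := by simp
  have h4 : (4 : ℤ) ∣ m ↔ 4 ∣ m := by omega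
  rw [Ntilde, h3, N_zero_right, N_zero_right]
  simp only [h4]
  split_ifs at h1 ⊢ <;> omega

lemma sum_sq_val_modEq {d : ℕ} (x : Fin d → ℤ) :
    ∑ i, ((x i : ZMod 4).val : ℤ) ^ 2 ≡ ∑ i, x i ^ 2 [ZMOD 8] := by
  refine Int.ModEq.sum fun i _ => ?_
  rw [ZMod.val_intCast, Int.modEq_iff_dvd]
  have h := Int.mul_ediv_add_emod (x i) 4
  push_cast
  refine ⟨2 * (x i / 4) ^ 2 + (x i / 4) * (x i % 4), ?_⟩
  nth_rewrite 1 [← h]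
  ring

lemma odd_val_iff (n : ℤ) : Odd ((n : ZMod 4).val : ℤ) ↔ Odd n := by
  rw [ZMod.val_intCast, Int.odd_iff, Int.odd_iff]
  push_cast
  omega

lemma sum_sq_modEq_of_odd {d : ℕ} {x : Fin d → ℤ} (h : ∀ i, Odd (x i)) :
    ∑ i, x i ^ 2 ≡ d [ZMOD 8] := by
  have := Int.ModEq.sum (s := Finset.univ) (f := fun i => x i ^ 2) (g := fun _ => 1) (n := 8)
    fun i _ => by
      obtain ⟨c, hc⟩ := h i
      obtain ⟨e, he⟩ := Int.even_mul_succ_self c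
      exact (Int.modEq_iff_dvd.2 ⟨e, by rw [hc]; linear_combination 4 * he⟩).symm
  simpa using this

lemma le_sum_sq_of_odd {d : ℕ} {x : Fin d → ℤ} (h : ∀ i, Odd (x i)) : d ≤ ∑ i, x i ^ 2 := by
  have := Finset.sum_le_sum (s := Finset.univ) (f := fun _ => (1 : ℤ)) (g := fun i => x i ^ 2)
    fun i _ => by
      have : x i ≠ 0 := fun h0 => by simpa [h0] using h i
      have : 0 < x i ^ 2 := by positivity
      omega
  simpa using this

/-- The indicator of `m ≡ d mod 8` with an odd coordinate, scaled by `C`, minus the indicator of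
all coordinates being odd. -/
noncomputable def defectWeight (d : ℕ) (C : ℝ) (x : Fin d → ℤ) : ℝ :=
  open Classical in
  C * (if ∑ i, x i ^ 2 ≡ d [ZMOD 8] ∧ ∃ i, Odd (x i) then 1 else 0) -
    if ∀ i, Odd (x i) then 1 else 0

lemma defectWeight_val (d : ℕ) (C : ℝ) (x : Fin d → ℤ) :
    defectWeight d C (fun i => ((x i : ZMod 4).val : ℤ)) = defectWeight d C x := by
  have h : ∑ i, ((x i : ZMod 4).val : ℤ) ^ 2 ≡ d [ZMOD 8] ↔ ∑ i, x i ^ 2 ≡ d [ZMOD 8] :=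
    ⟨(sum_sq_val_modEq x).symm.trans, (sum_sq_val_modEq x).trans⟩
  simp only [defectWeight, odd_val_iff, h]

lemma sum_defectWeight (d m : ℕ) (C : ℝ) :
    ∑ x ∈ latticeSphere d m, defectWeight d C x =
      if (m : ℤ) ≡ d [ZMOD 8] then C * (Ntilde d 0 m : ℝ) - (Nstar d 0 m : ℝ) else 0 := by
  classical
  split_ifs with h
  · have hsum : ∑ x ∈ latticeSphere d m, defectWeight d C x = ∑ x ∈ latticeSphere d m,
        (C * (if ∃ i, Odd (x i) then 1 else 0) - if ∀ i, Odd (x i) then 1 else 0) :=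
      Finset.sum_congr rfl fun x hx => by
        simp only [defectWeight, mem_latticeSphere.1 hx, h, true_and]
    rw [hsum, Finset.sum_sub_distrib, ← Finset.mul_sum, Finset.sum_boole, Finset.sum_boole,
      Ntilde_zero_right, Nstar_zero_right]
    push_cast
    rfl
  · refine Finset.sum_eq_zero fun x hx => ?_
    have hx' := mem_latticeSphere.1 hx
    have hodd : ¬ ∀ i, Odd (x i) := fun ho => h (hx' ▸ sum_sq_modEq_of_odd ho)
    simp only [defectWeight, hx', h, hodd, false_and, if_false, mul_zero, sub_zero]

lemma Nstar_zero_right_of_lt {d m : ℕ} (h : m < d) : Nstar d 0 m = 0 := by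
  rw [Nstar_zero_right, Finset.card_eq_zero, Finset.filter_eq_empty_iff]
  intro x hx ho
  have := le_sum_sq_of_odd ho
  rw [mem_latticeSphere.1 hx] at this
  omega

lemma Nstar_self_pos (d : ℕ) : 0 < Nstar d 0 d := by
  rw [Nstar_zero_right]
  exact Finset.card_pos.2 ⟨fun _ => 1, by simp [mem_latticeSphere]⟩

lemma Ntilde_pos {d m : ℕ} (hm : 0 < m) (h : m ≤ d) : 0 < Ntilde d 0 m := by
  rw [Ntilde_zero_right]
  refine Int.natCast_pos.2 (Finset.card_pos.2 ⟨fun i => if i.val < m then 1 else 0, ?_⟩)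
  rw [Finset.mem_filter, mem_latticeSphere]
  refine ⟨?_, ⟨0, by omega⟩, by simp [hm]⟩
  simp only [ite_pow, one_pow, ne_eq, OfNat.ofNat_ne_zero, not_false_eq_true, zero_pow,
    Finset.sum_boole, Fin.card_filter_val_lt, min_eq_right h]

lemma Ntilde_nonneg (d m : ℕ) : 0 ≤ Ntilde d 0 m := by
  rw [Ntilde_zero_right]
  positivity

theorem stmt_9 (a : ℕ) (ha : 4 ≤ a) (hmod : 4 ∣ a)
    (h : ∃ C : ℚ, ∀ n : ℕ,
        (Nstar a 0 (8 * (n : ℤ) + a) : ℚ) = C * (Ntilde a 0 (8 * (n : ℤ) + a) : ℚ)) :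
    a = 4 ∨ a = 8 := by
  by_contra! hne
  obtain ⟨C, hC⟩ := h
  have hC' (n : ℕ) : (Nstar a 0 (8 * n + a : ℕ) : ℝ) = C * (Ntilde a 0 (8 * n + a : ℕ) : ℝ) := by
    have := hC n
    push_cast
    exact_mod_cast this
  have hCpos : (0 : ℝ) < C := by
    have h0 := hC' 0
    simp only [mul_zero, zero_add] at h0
    have h1 : (0 : ℝ) < Nstar a 0 a := by exact_mod_cast Nstar_self_pos a
    have h2 : (0 : ℝ) ≤ Ntilde a 0 a := by exact_mod_cast Ntilde_nonneg a a
    rw [h0] at h1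
    exact pos_of_mul_pos_left h1 h2
  obtain ⟨k, rfl⟩ : ∃ k, a = 2 * k := ⟨a / 2, by omega⟩
  have hzero := sum_ball_eq_zero_of_sum_spheres_eq_zero (M := 2 * k) (by omega)
    (defectWeight_val (2 * k) C) fun m hm => by
      rw [sum_defectWeight]
      split_ifs with hm8
      · obtain ⟨n, rfl⟩ : ∃ n, m = 8 * n + 2 * k := ⟨(m - 2 * k) / 8, by
          have := Int.modEq_iff_dvd.1 hm8; omega⟩
        rw [hC', sub_self]
      · rfl
  refine (Finset.sum_pos' (fun m hm => ?_) ⟨2 * k - 8, ?_, ?_⟩).ne' hzero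
  · rw [sum_defectWeight, Nstar_zero_right_of_lt (Finset.mem_range.1 hm)]
    have : (0 : ℝ) ≤ Ntilde (2 * k) 0 m := by exact_mod_cast Ntilde_nonneg _ m
    split_ifs
    · simp only [Nat.cast_zero, sub_zero]
      positivity
    · exact le_rfl
  · rw [Finset.mem_range]
    omega
  · rw [sum_defectWeight, if_pos (Int.modEq_iff_dvd.2 (by omega)),
      Nstar_zero_right_of_lt (by omega)]
    have : (0 : ℝ) < Ntilde (2 * k) 0 (2 * k - 8 : ℕ) := by
      exact_mod_cast Ntilde_pos (by omega) (by omega)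
    simp only [Nat.cast_zero, sub_zero]
    positivity
end

section
/- Let a, b be nonnegative integers, both even, with a + b = 4k ≥ 4. Then there exists a cusp form C of weight 2k on Γ₀(12) (with trivial character) such that for all z in the upper half-plane: φ^a(z)·φ^b(3z) = b_{1,1}·[((−3)^{a/2}−1)·E_{2k}(z) + (3^{2k}−(−3)^{a/2})·E_{2k}(3z)] + b_{1,2}·[((−3)^{a/2}−1)·E_{2k}(2z) + (3^{2k}−(−3)^{a/2})·E_{2k}(6z)] + b_{1,4}·[((−3)^{a/2}−1)·E_{2k}(4z) + (3^{2k}−(−3)^{a/2})·E_{2k}(12z)] + C(z), where b_{1,1} = (−1)^{(a+3b)/4}/((2^{2k}−1)(3^{2k}−1)), b_{1,2} = −(1 + (−1)^{(a+3b)/4})/((2^{2k}−1)(3^{2k}−1)), and b_{1,4} = 2^{2k}/((2^{2k}−1)(3^{2k}−1)). -/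
open Complex

/-- The theta function `φ(z) = Σ_{m ∈ ℤ} q^{m²}` with `q = e^{2πiz}`, as a function of `z ∈ ℂ`. -/
noncomputable def phi (z : ℂ) : ℂ :=
  ∑' m : ℤ, Complex.exp (2 * Real.pi * Complex.I * z * ((m : ℂ) ^ 2))

/-- The weight `2k` Eisenstein series
`E_{2k}(z) = 1 - (4k/B_{2k}) Σ_{n ≥ 1} σ_{2k-1}(n) q^n` with `q = e^{2πiz}`. -/
noncomputable def E2k (k : ℕ) (z : ℂ) : ℂ :=
  1 - (4 * k / (bernoulli (2 * k) : ℂ)) *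
    ∑' n : ℕ, (ArithmeticFunction.sigma (2 * k - 1) (n + 1) : ℂ) *
      Complex.exp (2 * Real.pi * Complex.I * (n + 1) * z)

open ModularGroup Filter Topology
open scoped ModularForm MatrixGroups Manifold

theorem phi_eq_jacobiTheta (z : ℂ) : phi z = jacobiTheta (2 * z) :=
  tsum_congr fun m => congrArg _ (by ring)

/-- The companion `Σ_{m ∈ ℤ} q^{(m + 1/2)²}` of `phi`, expressed through `phi` itself. -/
noncomputable def psi (z : ℂ) : ℂ := phi (z / 4) - phi z

theorem phi_add_one (z : ℂ) : phi (z + 1) = phi z := by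
  rw [phi_eq_jacobiTheta, phi_eq_jacobiTheta, show 2 * (z + 1) = 2 + 2 * z by ring,
    jacobiTheta_two_add]

theorem summable_phi {z : ℂ} (hz : 0 < z.im) :
    Summable fun m : ℤ => exp (2 * Real.pi * I * z * ((m : ℂ) ^ 2)) := by
  refine ((summable_jacobiTheta₂_term_iff 0 (2 * z)).2 (by simpa using hz)).congr fun m => ?_
  rw [jacobiTheta₂_term]
  ring_nf

theorem exp_quarter_mul_odd_sq {m : ℤ} (hm : Odd m) :
    exp (2 * Real.pi * I * (1 / 4) * ((m : ℂ) ^ 2)) = I := by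
  obtain ⟨n, rfl⟩ := hm
  rw [show 2 * Real.pi * I * (1 / 4) * (((2 * n + 1 : ℤ) : ℂ) ^ 2)
      = Real.pi / 2 * I + (n * (n + 1) : ℤ) * (2 * Real.pi * I) by push_cast; ring,
    exp_add, exp_int_mul_two_pi_mul_I, mul_one, exp_pi_div_two_mul_I]

theorem exp_quarter_mul_even_sq (n : ℤ) :
    exp (2 * Real.pi * I * (1 / 4) * (((2 * n : ℤ) : ℂ) ^ 2)) = 1 := by
  rw [show 2 * Real.pi * I * (1 / 4) * (((2 * n : ℤ) : ℂ) ^ 2)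
      = (n ^ 2 : ℤ) * (2 * Real.pi * I) by push_cast; ring, exp_int_mul_two_pi_mul_I]

theorem phi_add_one_div_four {z : ℂ} (hz : 0 < z.im) :
    phi ((z + 1) / 4) = phi z + I * psi z := by
  have h4 : 0 < (z / 4).im := by
    rw [show (4 : ℂ) = ((4 : ℝ) : ℂ) by simp, div_ofReal_im]; positivity
  have h4' : 0 < ((z + 1) / 4).im := by
    rw [show (4 : ℂ) = ((4 : ℝ) : ℂ) by simp, div_ofReal_im]; simpa using hz
  have key : phi ((z + 1) / 4) - I * phi (z / 4) = (1 - I) * phi z := by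
    rw [phi, phi, phi, ← tsum_mul_left,
      ← (summable_phi h4').tsum_sub ((summable_phi h4).mul_left I),
      ← tsum_mul_left]
    have hterm (m : ℤ) : exp (2 * Real.pi * I * ((z + 1) / 4) * ((m : ℂ) ^ 2))
        = exp (2 * Real.pi * I * (1 / 4) * ((m : ℂ) ^ 2))
          * exp (2 * Real.pi * I * (z / 4) * ((m : ℂ) ^ 2)) := by
      rw [← exp_add]; ring_nf
    have hinj : Function.Injective fun n : ℤ => 2 * n := fun a b h => by simpa using h
    rw [← hinj.tsum_eq]
    · refine tsum_congr fun n => ?_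
      rw [hterm, exp_quarter_mul_even_sq, one_mul, ← one_sub_mul]
      push_cast
      ring_nf
    · intro m hm
      rcases Int.even_or_odd' m with ⟨n, rfl | h⟩
      · exact ⟨n, rfl⟩
      · refine absurd ?_ hm
        simp only
        rw [hterm, exp_quarter_mul_odd_sq ⟨n, h⟩, sub_self]
  rw [psi]
  linear_combination key

theorem psi_add_one {z : ℂ} (hz : 0 < z.im) : psi (z + 1) = I * psi z := by
  rw [psi, phi_add_one, phi_add_one_div_four hz]
  ring

theorem phi_neg_inv {z : ℂ} (hz : 0 < z.im) :
    phi (-z)⁻¹ = (-I * (z / 2)) ^ (1 / 2 : ℂ) * phi (z / 4) := by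
  have h2 : 0 < (z / 2).im := by
    rw [show (2 : ℂ) = ((2 : ℝ) : ℂ) by simp, div_ofReal_im]; positivity
  have h := jacobiTheta_S_smul ⟨z / 2, h2⟩
  rw [UpperHalfPlane.modular_S_smul] at h
  rw [phi_eq_jacobiTheta, phi_eq_jacobiTheta, show 2 * (z / 4) = z / 2 by ring, ← h]
  congr 1
  simp only [inv_neg, inv_div]
  ring

theorem sqrt_neg_I_mul_two_mul {z : ℂ} (hz : 0 < z.im) :
    (-I * (2 * z)) ^ (1 / 2 : ℂ) = 2 * (-I * (z / 2)) ^ (1 / 2 : ℂ) := by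
  have hz0 : z ≠ 0 := fun h => by simp [h] at hz
  have h4 : ((Real.log 4 : ℝ) : ℂ) * (1 / 2) = Real.log 2 := by
    rw [show (4 : ℝ) = 2 ^ 2 by norm_num, Real.log_pow]; push_cast; ring
  have h2 : exp (Real.log 2 : ℝ) = 2 := by
    rw [← ofReal_exp, Real.exp_log two_pos]; simp
  have hne : -I * (z / 2) ≠ 0 := by simp [hz0]
  rw [show -I * (2 * z) = ((4 : ℝ) : ℂ) * (-I * (z / 2)) by push_cast; ring,
    cpow_def_of_ne_zero (mul_ne_zero (by norm_num) hne), cpow_def_of_ne_zero hne,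
    log_ofReal_mul (by norm_num) hne, add_mul, exp_add, h4, h2]

theorem psi_neg_inv {z : ℂ} (hz : 0 < z.im) :
    psi (-z)⁻¹ = (-I * (z / 2)) ^ (1 / 2 : ℂ) * (phi z - psi z) := by
  have h4 : 0 < (4 * z).im := by simpa using hz
  have h := phi_neg_inv h4
  rw [show 4 * z / 2 = 2 * z by ring, sqrt_neg_I_mul_two_mul hz, show 4 * z / 4 = z by ring,
    show (-(4 * z))⁻¹ = (-z)⁻¹ / 4 by rw [← mul_neg, mul_inv]; ring] at h
  rw [psi, h, phi_neg_inv hz, psi]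
  ring

theorem sq_sqrt_neg_I_mul (z : ℂ) : ((-I * (z / 2)) ^ (1 / 2 : ℂ)) ^ 2 = -I * (z / 2) := by
  have h := cpow_nat_inv_pow (-I * (z / 2)) two_ne_zero
  rwa [Nat.cast_ofNat, ← one_div] at h

/-- The quadratic form in `(phi, psi)` describing `phi ^ 2` after the action of a matrix of
`SL(2, ℤ)` with bottom row `(c, d)` modulo `4`. -/
noncomputable def thetaForm (c d : ZMod 4) (x y : ℂ) : ℂ :=
  if c = 0 then (ZMod.χ₄ d : ℤ) * x ^ 2
  else if c = 2 then (ZMod.χ₄ d : ℤ) * y ^ 2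
  else (ZMod.χ₄ c : ℤ) * (-I / 2) * (x + I ^ (c * d).val * y) ^ 2

theorem thetaForm_mul (c d : ZMod 4) (s x y : ℂ) :
    thetaForm c d (s * x) (s * y) = s ^ 2 * thetaForm c d x y := by
  unfold thetaForm
  split_ifs <;> ring

theorem thetaForm_zero_left (d : ZMod 4) (x y : ℂ) :
    thetaForm 0 d x y = (ZMod.χ₄ d : ℤ) * x ^ 2 := if_pos rfl

theorem thetaForm_two_left (d : ZMod 4) (x y : ℂ) :
    thetaForm 2 d x y = (ZMod.χ₄ d : ℤ) * y ^ 2 := by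
  rw [thetaForm, if_neg (by decide), if_pos rfl]

theorem thetaForm_one_left (d : ZMod 4) (x y : ℂ) :
    thetaForm 1 d x y = -I / 2 * (x + I ^ d.val * y) ^ 2 := by
  rw [thetaForm, if_neg (by decide), if_neg (by decide), one_mul]
  simp

theorem thetaForm_three_left (d : ZMod 4) (x y : ℂ) :
    thetaForm 3 d x y = I / 2 * (x + I ^ (3 * d).val * y) ^ 2 := by
  rw [thetaForm, if_neg (by decide), if_neg (by decide), show ZMod.χ₄ 3 = -1 from rfl]
  push_cast
  ring

theorem ZMod.four_cases (c : ZMod 4) : c = 0 ∨ c = 1 ∨ c = 2 ∨ c = 3 := by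
  decide +revert

theorem thetaForm_T (c d : ZMod 4) (x y : ℂ) :
    thetaForm c d x (I * y) = thetaForm c (c + d) x y := by
  have h3 : I ^ 3 = -I := I_pow_three
  have v0 : (0 : ZMod 4).val = 0 := rfl
  have v1 : (1 : ZMod 4).val = 1 := rfl
  have v2 : (2 : ZMod 4).val = 2 := rfl
  have v3 : (3 : ZMod 4).val = 3 := rfl
  have c0 : ZMod.χ₄ 0 = 0 := rfl
  have c1 : ZMod.χ₄ 1 = 1 := rfl
  have c2 : ZMod.χ₄ 2 = 0 := rfl
  have c3 : ZMod.χ₄ 3 = -1 := rfl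
  rcases ZMod.four_cases c with rfl | rfl | rfl | rfl <;>
  rcases ZMod.four_cases d with rfl | rfl | rfl | rfl <;>
  reduce_mod_char <;>
  simp only [thetaForm_zero_left, thetaForm_one_left, thetaForm_two_left, thetaForm_three_left] <;>
  reduce_mod_char <;>
  simp only [v0, v1, v2, v3, c0, c1, c2, c3] <;> push_cast <;> grind [I_sq]

theorem thetaForm_S (c d : ZMod 4) (x y : ℂ) :
    -I / 2 * thetaForm c d (x + y) (x - y) = thetaForm d (-c) x y := by
  have h3 : I ^ 3 = -I := I_pow_three
  have v0 : (0 : ZMod 4).val = 0 := rfl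
  have v1 : (1 : ZMod 4).val = 1 := rfl
  have v2 : (2 : ZMod 4).val = 2 := rfl
  have v3 : (3 : ZMod 4).val = 3 := rfl
  have c0 : ZMod.χ₄ 0 = 0 := rfl
  have c1 : ZMod.χ₄ 1 = 1 := rfl
  have c2 : ZMod.χ₄ 2 = 0 := rfl
  have c3 : ZMod.χ₄ 3 = -1 := rfl
  rcases ZMod.four_cases c with rfl | rfl | rfl | rfl <;>
  rcases ZMod.four_cases d with rfl | rfl | rfl | rfl <;>
  reduce_mod_char <;>
  simp only [thetaForm_zero_left, thetaForm_one_left, thetaForm_two_left, thetaForm_three_left] <;>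
  reduce_mod_char <;>
  simp only [v0, v1, v2, v3, c0, c1, c2, c3] <;> push_cast <;> grind [I_sq]

/-- `thetaForm` evaluated at `(phi, psi)`, indexed by a row vector modulo `4`. -/
noncomputable def thetaSq (v : Fin 2 → ZMod 4) (z : UpperHalfPlane) : ℂ :=
  thetaForm (v 0) (v 1) (phi z) (psi z)

/-- The reduction of an integral matrix modulo `4`. -/
def redMod4 (γ : SL(2, ℤ)) : Matrix (Fin 2) (Fin 2) (ZMod 4) :=
  (γ : Matrix (Fin 2) (Fin 2) ℤ).map (Int.cast : ℤ → ZMod 4)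

theorem redMod4_one : redMod4 1 = 1 := by
  rw [redMod4, Matrix.SpecialLinearGroup.coe_one]
  exact Matrix.map_one _ Int.cast_zero Int.cast_one

theorem redMod4_mul (γ δ : SL(2, ℤ)) : redMod4 (γ * δ) = redMod4 γ * redMod4 δ := by
  rw [redMod4, Matrix.SpecialLinearGroup.coe_mul]
  exact Matrix.map_mul (f := Int.castRingHom (ZMod 4))

theorem thetaSq_slash_T (v : Fin 2 → ZMod 4) :
    thetaSq v ∣[(1 : ℤ)] T = thetaSq (Matrix.vecMul v (redMod4 T)) := by
  ext z
  rw [ModularForm.SL_slash_apply, UpperHalfPlane.modular_T_smul]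
  have hcoe : (((1 : ℝ) +ᵥ z : UpperHalfPlane) : ℂ) = z + 1 := by
    rw [UpperHalfPlane.coe_vadd]; push_cast; ring
  have h0 : Matrix.vecMul v (redMod4 T) 0 = v 0 := by
    simp [Matrix.vecMul, dotProduct, Fin.sum_univ_two, redMod4, T]
  have h1 : Matrix.vecMul v (redMod4 T) 1 = v 0 + v 1 := by
    simp [Matrix.vecMul, dotProduct, Fin.sum_univ_two, redMod4, T]
  simp only [thetaSq, hcoe, h0, h1, phi_add_one, psi_add_one z.im_pos, thetaForm_T]
  rw [ModularGroup.denom_apply]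
  simp [T]

theorem thetaSq_slash_S (v : Fin 2 → ZMod 4) :
    thetaSq v ∣[(1 : ℤ)] S = thetaSq (Matrix.vecMul v (redMod4 S)) := by
  ext z
  have hz := z.ne_zero
  rw [ModularForm.SL_slash_apply, UpperHalfPlane.modular_S_smul]
  have h0 : Matrix.vecMul v (redMod4 S) 0 = v 1 := by
    simp [Matrix.vecMul, dotProduct, Fin.sum_univ_two, redMod4, S]
  have h1 : Matrix.vecMul v (redMod4 S) 1 = -v 0 := by
    simp [Matrix.vecMul, dotProduct, Fin.sum_univ_two, redMod4, S]
  have hphi : phi (z / 4) = phi z + psi z := by rw [psi]; ring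
  simp only [thetaSq, h0, h1, phi_neg_inv z.im_pos, psi_neg_inv z.im_pos, thetaForm_mul,
    sq_sqrt_neg_I_mul, hphi, ← thetaForm_S, ModularGroup.denom_S]
  field_simp

theorem thetaSq_slash (γ : SL(2, ℤ)) (v : Fin 2 → ZMod 4) :
    thetaSq v ∣[(1 : ℤ)] γ = thetaSq (Matrix.vecMul v (redMod4 γ)) := by
  have hγ : γ ∈ Subgroup.closure {S, T} := by
    simp [SpecialLinearGroup.SL2Z_generators]
  induction hγ using Subgroup.closure_induction generalizing v with
  | mem x hx =>
    obtain rfl | rfl := hx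
    · exact thetaSq_slash_S v
    · exact thetaSq_slash_T v
  | one => rw [SlashAction.slash_one, redMod4_one, Matrix.vecMul_one]
  | mul x y _ _ hx hy =>
    rw [SlashAction.slash_mul, hx, hy, redMod4_mul, Matrix.vecMul_vecMul]
  | inv x _ hx =>
    set w := Matrix.vecMul v (redMod4 x⁻¹) with hw
    have h : Matrix.vecMul w (redMod4 x) = v := by
      rw [hw, Matrix.vecMul_vecMul, ← redMod4_mul, inv_mul_cancel, redMod4_one,
        Matrix.vecMul_one]
    rw [← h, ← hx, ← SlashAction.slash_mul, mul_inv_cancel, SlashAction.slash_one]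

/-- The matrix of `SL(2, ℤ)` with given entries. -/
def slOfDet (A B C D : ℤ) (h : A * D - B * C = 1) : SL(2, ℤ) :=
  ⟨!![A, B; C, D], by rw [Matrix.det_fin_two_of, h]⟩

theorem coe_slOfDet_smul {A B C D : ℤ} (h : A * D - B * C = 1) (z : UpperHalfPlane) :
    ((slOfDet A B C D h • z : UpperHalfPlane) : ℂ) = (A * z + B) / (C * z + D) := by
  rw [UpperHalfPlane.specialLinearGroup_apply]
  simp [slOfDet]

theorem denom_slOfDet {A B C D : ℤ} (h : A * D - B * C = 1) (z : UpperHalfPlane) :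
    UpperHalfPlane.denom (slOfDet A B C D h) z = C * z + D := by
  rw [ModularGroup.denom_apply]
  simp [slOfDet]

theorem phi_sq_moebius {A B C D : ℤ} (h : A * D - B * C = 1) {z : ℂ} (hz : 0 < z.im) :
    phi ((A * z + B) / (C * z + D)) ^ 2
      = (C * z + D) * thetaForm (C : ZMod 4) (D : ZMod 4) (phi z) (psi z) := by
  lift z to UpperHalfPlane using hz
  have hs := congrFun (thetaSq_slash (slOfDet A B C D h) ![0, 1]) z
  have hd := UpperHalfPlane.denom_ne_zero (slOfDet A B C D h) z
  have e0 : Matrix.vecMul ![0, 1] (redMod4 (slOfDet A B C D h)) 0 = C := by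
    simp [Matrix.vecMul, dotProduct, Fin.sum_univ_two, redMod4, slOfDet]
  have e1 : Matrix.vecMul ![0, 1] (redMod4 (slOfDet A B C D h)) 1 = D := by
    simp [Matrix.vecMul, dotProduct, Fin.sum_univ_two, redMod4, slOfDet]
  rw [ModularForm.SL_slash_apply, zpow_neg_one, ← div_eq_mul_inv, div_eq_iff hd,
    denom_slOfDet] at hs
  simp only [thetaSq, e0, e1, coe_slOfDet_smul] at hs
  simp only [Matrix.cons_val_zero, Matrix.cons_val_one, thetaForm_zero_left, map_one,
    Int.cast_one, one_mul] at hs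
  rw [hs, mul_comm]

theorem E2k_eq_tsum_pnat (k : ℕ) (z : ℂ) :
    E2k k z = 1 - (4 * k / (bernoulli (2 * k) : ℂ)) *
      ∑' n : ℕ+, (ArithmeticFunction.sigma (2 * k - 1) n : ℂ) *
        exp (2 * Real.pi * I * z) ^ (n : ℕ) := by
  rw [E2k, tsum_pnat_eq_tsum_succ (f := fun n : ℕ =>
    (ArithmeticFunction.sigma (2 * k - 1) n : ℂ) * exp (2 * Real.pi * I * z) ^ n)]
  congr 2
  refine tsum_congr fun n => ?_
  rw [← exp_nat_mul]
  push_cast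
  ring_nf

theorem E2k_eq_E {k : ℕ} (hk : 3 ≤ 2 * k) (z : UpperHalfPlane) :
    E2k k z = ModularForm.E hk z := by
  rw [EisensteinSeries.q_expansion_bernoulli hk (even_two_mul k), E2k_eq_tsum_pnat]
  push_cast
  rw [show (4 * k : ℂ) = 2 * (2 * k) by ring]
  simp

theorem E2k_one_eq_E2 (z : UpperHalfPlane) : E2k 1 z = EisensteinSeries.E2 z := by
  rw [EisensteinSeries.E2_eq_tsum_cexp, E2k_eq_tsum_pnat]
  norm_num [bernoulli_two]

theorem mdifferentiable_E2k {k : ℕ} (hk : 1 ≤ k) :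
    MDiff (fun z : UpperHalfPlane => E2k k z) := by
  obtain rfl | hk2 := hk.eq_or_lt
  · simpa only [E2k_one_eq_E2] using E2_mdifferentiable
  · simp only [E2k_eq_E (show 3 ≤ 2 * k by omega)]
    exact (ModularForm.E (show 3 ≤ 2 * k by omega)).holo'

theorem exists_E2k_moebius {k : ℕ} (hk : 1 ≤ k) :
    ∃ κ : ℂ, (k ≠ 1 → κ = 0) ∧ ∀ {A B C D : ℤ} (_ : A * D - B * C = 1) {z : ℂ} (_ : 0 < z.im),
      E2k k ((A * z + B) / (C * z + D))
        = (C * z + D) ^ (2 * k) * E2k k z + κ * C * (C * z + D) := by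
  obtain rfl | hk2 := hk.eq_or_lt
  · refine ⟨1 / (2 * riemannZeta 2) * -(2 * Real.pi * I), by simp, fun {A B C D} h z hz => ?_⟩
    lift z to UpperHalfPlane using hz
    have hs := congrFun (EisensteinSeries.E2_slash_action (slOfDet A B C D h)) z
    have hd := UpperHalfPlane.denom_ne_zero (slOfDet A B C D h) z
    have hC : (slOfDet A B C D h) 1 0 = C := rfl
    simp only [ModularForm.SL_slash_apply, Pi.sub_apply, Pi.smul_apply, smul_eq_mul,
      EisensteinSeries.D2, ← E2k_one_eq_E2, coe_slOfDet_smul, hC] at hs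
    rw [denom_slOfDet] at hs hd
    rw [zpow_neg, ← div_eq_mul_inv, div_eq_iff (zpow_ne_zero _ hd)] at hs
    rw [hs]
    norm_cast at hd ⊢
    field_simp
    ring
  · refine ⟨0, fun _ => rfl, fun {A B C D} h z hz => ?_⟩
    lift z to UpperHalfPlane using hz
    have hk3 : 3 ≤ 2 * k := by omega
    have hs := SlashInvariantForm.slash_action_eqn'' (Γ := 𝒮ℒ) (ModularForm.E hk3)
      (γ := (slOfDet A B C D h : GL (Fin 2) ℝ)) ⟨_, rfl⟩ z
    rw [denom_slOfDet] at hs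
    have hs' := E2k_eq_E hk3 (slOfDet A B C D h • z)
    rw [coe_slOfDet_smul] at hs'
    rw [hs', E2k_eq_E hk3, zero_mul, zero_mul, add_zero, ← zpow_natCast]
    exact hs

theorem tendsto_affine_comap_im {r : ℝ} (hr : 0 < r) (t : ℝ) :
    Tendsto (fun z : ℂ => r * z + t) (comap im atTop) (comap im atTop) := by
  rw [tendsto_comap_iff]
  have h : im ∘ (fun z : ℂ => r * z + t) = fun z => r * z.im := by
    ext z
    simp
  rw [h]
  exact tendsto_comap.const_mul_atTop hr

theorem tendsto_phi : Tendsto phi (comap im atTop) (𝓝 1) := by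
  have h0 : Tendsto (fun z : ℂ => Real.exp (-Real.pi * z.im)) (comap im atTop) (𝓝 0) :=
    Real.tendsto_exp_atBot.comp
      (tendsto_comap.const_mul_atTop_of_neg (neg_neg_of_pos Real.pi_pos))
  have h1 := (isBigO_at_im_infty_jacobiTheta_sub_one.trans_tendsto h0).comp
    (tendsto_affine_comap_im two_pos 0)
  have h2 := h1.add_const 1
  simp only [Function.comp_def, sub_add_cancel, zero_add, ofReal_zero, add_zero, ofReal_ofNat] at h2
  exact h2.congr fun z => (phi_eq_jacobiTheta z).symm

theorem tendsto_psi : Tendsto psi (comap im atTop) (𝓝 0) := by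
  have h1 := tendsto_phi.comp (tendsto_affine_comap_im (r := 1 / 4) (by norm_num) 0)
  have h2 := h1.sub tendsto_phi
  rw [sub_self] at h2
  refine h2.congr fun z => ?_
  simp only [Function.comp_def, psi]
  push_cast
  ring_nf

theorem tendsto_E2k {k : ℕ} (hk : 1 ≤ k) : Tendsto (E2k k) (comap im atTop) (𝓝 1) := by
  have hnorm (n : ℕ) (z : ℂ) :
      ‖(ArithmeticFunction.sigma (2 * k - 1) (n + 1) : ℂ) * exp (2 * Real.pi * I * (n + 1) * z)‖
        = ArithmeticFunction.sigma (2 * k - 1) (n + 1)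
          * Real.exp (-(2 * Real.pi * (n + 1)) * z.im) := by
    rw [norm_mul, norm_natCast, norm_exp]
    congr 2
    simp
  have hsum : Summable fun n : ℕ => (ArithmeticFunction.sigma (2 * k - 1) (n + 1) : ℝ)
      * Real.exp (-(2 * Real.pi * (n + 1)) * 1) := by
    have h := ((summable_nat_add_iff 1).2 (EisensteinSeries.summable_sigma_mul_cexp_pow
      (show 1 ≤ 2 * k by omega) UpperHalfPlane.I)).norm
    refine h.congr fun n => ?_
    have := hnorm n I
    rw [I_im] at this
    rw [← this, ← exp_nat_mul, UpperHalfPlane.coe_I]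
    push_cast
    ring_nf
  have hlim : Tendsto (fun z : ℂ => ∑' n : ℕ, (ArithmeticFunction.sigma (2 * k - 1) (n + 1) : ℂ) *
      exp (2 * Real.pi * I * (n + 1) * z)) (comap im atTop) (𝓝 (∑' _ : ℕ, 0)) := by
    refine tendsto_tsum_of_dominated_convergence hsum (fun n => ?_) ?_
    · rw [tendsto_zero_iff_norm_tendsto_zero]
      simp only [hnorm]
      rw [← mul_zero (ArithmeticFunction.sigma (2 * k - 1) (n + 1) : ℝ)]
      refine (Real.tendsto_exp_atBot.comp (tendsto_comap.const_mul_atTop_of_neg ?_)).const_mul _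
      exact neg_neg_of_pos (by positivity)
    · filter_upwards [tendsto_comap.eventually_ge_atTop 1] with z hz n
      rw [hnorm]
      refine mul_le_mul_of_nonneg_left (Real.exp_le_exp.2 ?_) (Nat.cast_nonneg _)
      exact mul_le_mul_of_nonpos_left hz (neg_nonpos.2 (by positivity))
  have h := (hlim.const_mul (4 * k / (bernoulli (2 * k) : ℂ))).const_sub 1
  rw [tsum_zero, mul_zero, sub_zero] at h
  exact h

theorem moebius_denom_ne_zero {A B C D : ℤ} (h : A * D - B * C = 1) {z : ℂ} (hz : 0 < z.im) :
    (C * z + D : ℂ) ≠ 0 := by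
  lift z to UpperHalfPlane using hz
  rw [← denom_slOfDet h]
  exact UpperHalfPlane.denom_ne_zero _ z

theorem im_affine_pos {r : ℝ} (hr : 0 < r) (t : ℝ) {z : ℂ} (hz : 0 < z.im) :
    0 < (r * z + t : ℂ).im := by
  simpa using mul_pos hr hz

/-- Factorization of `diag(N, 1) * γ` as a unimodular matrix times an upper triangular one. -/
theorem exists_hecke_factor {N : ℕ} (hN : 0 < N) {A B C D : ℤ} (h : A * D - B * C = 1) :
    ∃ c n w t : ℤ, 0 < n ∧ (N : ℤ) = C.gcd N * n ∧ C = C.gcd N * c ∧ c * t + w * n = D ∧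
      (A * n) * w - (C.gcd N * B - A * t) * c = 1 := by
  have hN' : (N : ℤ) ≠ 0 := by exact_mod_cast hN.ne'
  have hg : 0 < C.gcd N := Int.gcd_pos_of_ne_zero_right _ hN'
  obtain ⟨c, hc⟩ := Int.gcd_dvd_left C N
  obtain ⟨n, hn⟩ := Int.gcd_dvd_right C N
  have hn0 : 0 < n := by
    refine pos_of_mul_pos_right (a := (C.gcd N : ℤ)) ?_ (by positivity)
    rw [← hn]; exact_mod_cast hN
  have hb := Int.gcd_eq_gcd_ab C N
  have hcop : c * C.gcdA N + n * C.gcdB N = 1 := by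
    have hg' : (C.gcd N : ℤ) ≠ 0 := by exact_mod_cast hg.ne'
    apply mul_left_cancel₀ hg'
    linear_combination -hb - C.gcdA N * hc - C.gcdB N * hn
  refine ⟨c, n, C.gcdB N * D, C.gcdA N * D, hn0, hn, hc, by linear_combination D * hcop, ?_⟩
  linear_combination h + A * D * hcop + B * hc

theorem hecke_factor_denom {C D g c n w t : ℤ} (hn : 0 < n) (hC : C = g * c)
    (hD : c * t + w * n = D) (z : ℂ) :
    (c * ((g / n : ℝ) * z + (t / n : ℝ)) + w : ℂ) = (C * z + D) / n := by
  have hn' : (n : ℂ) ≠ 0 := by exact_mod_cast hn.ne'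
  rw [hC, ← hD]
  push_cast
  field_simp
  ring

theorem hecke_factor_moebius {A B C D N g c n w t : ℤ} (hn : 0 < n) (hN : N = g * n)
    (hC : C = g * c) (hD : c * t + w * n = D) (z : ℂ) :
    (N * ((A * z + B) / (C * z + D)) : ℂ)
      = ((A * n : ℤ) * ((g / n : ℝ) * z + (t / n : ℝ)) + (g * B - A * t : ℤ))
        / (c * ((g / n : ℝ) * z + (t / n : ℝ)) + w) := by
  have hn' : (n : ℂ) ≠ 0 := by exact_mod_cast hn.ne'
  rw [hecke_factor_denom hn hC hD, hN, div_div_eq_mul_div, mul_div_assoc']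
  congr 1
  push_cast
  field_simp
  ring

theorem exists_E2k_mul_moebius {k : ℕ} (hk : 1 ≤ k) :
    ∃ κ : ℂ, (k ≠ 1 → κ = 0) ∧ ∀ {N : ℕ} (_ : 0 < N) {A B C D : ℤ} (_ : A * D - B * C = 1),
      ∃ n t : ℤ, 0 < n ∧ (N : ℤ) = C.gcd N * n ∧ ∀ {z : ℂ} (_ : 0 < z.im),
        E2k k (N * ((A * z + B) / (C * z + D)))
          = (C * z + D) ^ (2 * k) * (E2k k ((C.gcd N / n : ℝ) * z + (t / n : ℝ)) / n ^ (2 * k))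
            + κ * (C / N) * (C * z + D) := by
  obtain ⟨κ, hκ, H⟩ := exists_E2k_moebius hk
  refine ⟨κ, hκ, fun {N} hN {A B C D} h => ?_⟩
  obtain ⟨c, n, w, t, hn, hNn, hC, hD, hdet⟩ := exists_hecke_factor hN h
  refine ⟨n, t, hn, hNn, fun {z} hz => ?_⟩
  have hg : 0 < C.gcd N := Int.gcd_pos_of_ne_zero_right _ (by exact_mod_cast hN.ne')
  have hn' : (0 : ℝ) < n := by exact_mod_cast hn
  have hz' := im_affine_pos (r := C.gcd N / n) (by positivity) (t / n) hz
  have hnC : (n : ℂ) ≠ 0 := by exact_mod_cast hn.ne'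
  have hgC : (C.gcd N : ℂ) ≠ 0 := by exact_mod_cast hg.ne'
  have hcn : (c / n : ℂ) = C / N := by
    have h1 : (C : ℂ) = C.gcd N * c := by exact_mod_cast hC
    have h2 : (N : ℂ) = C.gcd N * n := by exact_mod_cast hNn
    rw [h2]
    nth_rw 1 [h1]
    field_simp
  have e := hecke_factor_moebius (A := A) (B := B) hn hNn hC hD z
  have e' := H hdet hz'
  have e'' := hecke_factor_denom hn hC hD z
  simp only [Int.cast_natCast] at e e' e''
  rw [e, e', e'', ← hcn, div_pow]
  ring

theorem tendsto_inv_moebius_denom {C : ℤ} (hC : C ≠ 0) (D : ℤ) :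
    Tendsto (fun z : ℂ => (C * z + D : ℂ)⁻¹) (comap im atTop) (𝓝 0) := by
  refine tendsto_inv₀_cobounded.comp (tendsto_norm_atTop_iff_cobounded.1 ?_)
  have hC' : (0 : ℝ) < |(C : ℝ)| := by simpa using hC
  refine tendsto_atTop_mono (fun z => ?_) (tendsto_comap.const_mul_atTop hC')
  have := abs_im_le_norm (C * z + D)
  simp only [add_im, mul_im, intCast_re, intCast_im, zero_mul, add_zero, abs_mul] at this
  exact (mul_le_mul_of_nonneg_left (le_abs_self _) hC'.le).trans this

theorem eventually_im_pos : ∀ᶠ z : ℂ in comap im atTop, 0 < z.im :=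
  tendsto_comap.eventually_gt_atTop 0

theorem tendsto_E2k_mul_moebius {k N : ℕ} (hk : 1 ≤ k) (hN : 0 < N) {A B C D : ℤ}
    (h : A * D - B * C = 1) :
    Tendsto (fun z : ℂ => E2k k (N * ((A * z + B) / (C * z + D))) / (C * z + D) ^ (2 * k))
      (comap im atTop) (𝓝 ((C.gcd N / N : ℂ) ^ (2 * k))) := by
  obtain ⟨κ, hκ, H⟩ := exists_E2k_mul_moebius hk
  obtain ⟨n, t, hn, hNn, hE⟩ := H hN h
  have hg : 0 < C.gcd N := Int.gcd_pos_of_ne_zero_right _ (by exact_mod_cast hN.ne')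
  have hn' : (0 : ℝ) < n := by exact_mod_cast hn
  have hnC : (n : ℂ) ≠ 0 := by exact_mod_cast hn.ne'
  have hgC : (C.gcd N : ℂ) ≠ 0 := by exact_mod_cast hg.ne'
  have hrem : Tendsto (fun z : ℂ => κ * (C / N) * (C * z + D) / (C * z + D) ^ (2 * k))
      (comap im atTop) (𝓝 0) := by
    by_cases hk1 : k = 1
    · by_cases hC : C = 0
      · simp [hC, tendsto_const_nhds]
      · have h1 := (tendsto_inv_moebius_denom hC D).const_mul (κ * (C / N))
        rw [mul_zero] at h1
        refine h1.congr' ?_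
        filter_upwards [eventually_im_pos] with z hz
        have := moebius_denom_ne_zero h hz
        rw [hk1]
        field_simp
    · simp [hκ hk1, tendsto_const_nhds]
  have hmain := ((tendsto_E2k hk).comp (tendsto_affine_comap_im
    (r := C.gcd N / n) (by positivity) (t / n))).div_const ((n : ℂ) ^ (2 * k))
  have hlim : (C.gcd N / N : ℂ) ^ (2 * k) = 1 / (n : ℂ) ^ (2 * k) + 0 := by
    have h2 : (N : ℂ) = C.gcd N * n := by exact_mod_cast hNn
    rw [h2, add_zero, ← one_div_pow]
    congr 1
    field_simp
  rw [hlim]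
  refine (hmain.add hrem).congr' ?_
  filter_upwards [eventually_im_pos] with z hz
  have := moebius_denom_ne_zero h hz
  rw [hE hz, add_div, mul_div_cancel_left₀ _ (pow_ne_zero _ this)]
  rfl

theorem phi_sq_mul_moebius {N : ℕ} {A B C D g c n w t : ℤ} (hg : 0 < g) (hn : 0 < n)
    (hN : (N : ℤ) = g * n) (hC : C = g * c) (hD : c * t + w * n = D)
    (hdet : (A * n) * w - (g * B - A * t) * c = 1) {z : ℂ} (hz : 0 < z.im) :
    phi (N * ((A * z + B) / (C * z + D))) ^ 2
      = (C * z + D) * (thetaForm c w (phi ((g / n : ℝ) * z + (t / n : ℝ)))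
        (psi ((g / n : ℝ) * z + (t / n : ℝ))) / n) := by
  have hn' : (0 : ℝ) < n := by exact_mod_cast hn
  have hg' : (0 : ℝ) < g := by exact_mod_cast hg
  have hz' := im_affine_pos (r := g / n) (by positivity) (t / n) hz
  have e := hecke_factor_moebius (A := A) (B := B) hn hN hC hD z
  rw [Int.cast_natCast] at e
  rw [e, phi_sq_moebius hdet hz', hecke_factor_denom hn hC hD]
  ring

theorem tendsto_thetaForm (c d : ZMod 4) {r : ℝ} (hr : 0 < r) (s : ℝ) :
    Tendsto (fun z : ℂ => thetaForm c d (phi (r * z + s)) (psi (r * z + s)))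
      (comap im atTop) (𝓝 (thetaForm c d 1 0)) := by
  have h1 := tendsto_phi.comp (tendsto_affine_comap_im hr s)
  have h2 := tendsto_psi.comp (tendsto_affine_comap_im hr s)
  unfold thetaForm
  split_ifs
  · exact (h1.pow 2).const_mul _
  · exact (h2.pow 2).const_mul _
  · exact ((h1.add (h2.const_mul _)).pow 2).const_mul _

theorem tendsto_phi_sq_mul_moebius {N : ℕ} {A B C D g c n w t : ℤ}
    (h : A * D - B * C = 1) (hg : 0 < g) (hn : 0 < n)
    (hN : (N : ℤ) = g * n) (hC : C = g * c) (hD : c * t + w * n = D)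
    (hdet : (A * n) * w - (g * B - A * t) * c = 1) :
    Tendsto (fun z : ℂ => phi (N * ((A * z + B) / (C * z + D))) ^ 2 / (C * z + D))
      (comap im atTop) (𝓝 (thetaForm c w 1 0 / n)) := by
  have hn' : (0 : ℝ) < n := by exact_mod_cast hn
  have hg' : (0 : ℝ) < g := by exact_mod_cast hg
  refine ((tendsto_thetaForm c w (r := g / n) (by positivity) (t / n)).div_const (n : ℂ)).congr' ?_
  filter_upwards [eventually_im_pos] with z hz
  rw [phi_sq_mul_moebius hg hn hN hC hD hdet hz,
    mul_div_cancel_left₀ _ (moebius_denom_ne_zero h hz)]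

/-- The linear combination of `f 1, f 2, f 3, f 4, f 6, f 12` with the coefficients of the
Eisenstein part. -/
noncomputable def eisComb (k m e : ℕ) (f : ℕ → ℂ) : ℂ :=
  ((-1 : ℂ) ^ e / ((2 ^ (2 * k) - 1) * (3 ^ (2 * k) - 1))) *
      (((-3 : ℂ) ^ m - 1) * f 1 + ((3 : ℂ) ^ (2 * k) - (-3 : ℂ) ^ m) * f 3) +
    (-(1 + (-1 : ℂ) ^ e) / ((2 ^ (2 * k) - 1) * (3 ^ (2 * k) - 1))) *
      (((-3 : ℂ) ^ m - 1) * f 2 + ((3 : ℂ) ^ (2 * k) - (-3 : ℂ) ^ m) * f 6) +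
    ((2 : ℂ) ^ (2 * k) / ((2 ^ (2 * k) - 1) * (3 ^ (2 * k) - 1))) *
      (((-3 : ℂ) ^ m - 1) * f 4 + ((3 : ℂ) ^ (2 * k) - (-3 : ℂ) ^ m) * f 12)

theorem eisComb_congr {k m e : ℕ} {f g : ℕ → ℂ} (h : ∀ N, 0 < N → N ∣ 12 → f N = g N) :
    eisComb k m e f = eisComb k m e g := by
  unfold eisComb
  rw [h 1 (by decide) (by decide), h 2 (by decide) (by decide), h 3 (by decide) (by decide),
    h 4 (by decide) (by decide), h 6 (by decide) (by decide), h 12 (by decide) (by decide)]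

theorem eisComb_mul_add_mul (k m e : ℕ) (f g : ℕ → ℂ) (r s : ℂ) :
    eisComb k m e (fun N => r * f N + s * g N) = r * eisComb k m e f + s * eisComb k m e g := by
  unfold eisComb
  ring

theorem eisComb_div (k m e : ℕ) (f : ℕ → ℂ) (r : ℂ) :
    eisComb k m e (fun N => f N / r) = eisComb k m e f / r := by
  unfold eisComb
  ring

theorem tendsto_eisComb {k m e : ℕ} {F : ℕ → ℂ → ℂ} {g : ℕ → ℂ} {l : Filter ℂ}
    (h : ∀ N, 0 < N → Tendsto (F N) l (𝓝 (g N))) :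
    Tendsto (fun z => eisComb k m e (fun N => F N z)) l (𝓝 (eisComb k m e g)) := by
  have h1 := h 1 (by decide)
  have h2 := h 2 (by decide)
  have h3 := h 3 (by decide)
  have h4 := h 4 (by decide)
  have h6 := h 6 (by decide)
  have h12 := h 12 (by decide)
  unfold eisComb
  exact (((h1.const_mul _).add (h3.const_mul _)).const_mul _ |>.add
    (((h2.const_mul _).add (h6.const_mul _)).const_mul _)).add
    (((h4.const_mul _).add (h12.const_mul _)).const_mul _)

theorem eisComb_of_mul {k m e : ℕ} {f : ℕ → ℂ} (h1 : f 1 = 1) (h6 : f 6 = f 3 * f 2)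
    (h12 : f 12 = f 3 * f 4) :
    eisComb k m e f
      = (((-3) ^ m - 1 + (3 ^ (2 * k) - (-3) ^ m) * f 3) / (3 ^ (2 * k) - 1))
        * (((-1) ^ e - (1 + (-1) ^ e) * f 2 + 2 ^ (2 * k) * f 4) / (2 ^ (2 * k) - 1)) := by
  unfold eisComb
  rw [h1, h6, h12, div_mul_div_comm, mul_comm ((3 : ℂ) ^ (2 * k) - 1)]
  ring

theorem eisComb_inv {m l : ℕ} (h : m + l = 2) :
    eisComb 1 m (1 + l) (fun N => (N : ℂ)⁻¹) = 0 := by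
  rw [eisComb_of_mul (by simp) (by norm_num) (by norm_num)]
  obtain ⟨rfl, rfl⟩ | ⟨rfl, rfl⟩ | ⟨rfl, rfl⟩ : m = 0 ∧ l = 2 ∨ m = 1 ∧ l = 1 ∨ m = 2 ∧ l = 0 := by
    omega
  all_goals norm_num

theorem eisComb_gcd {k m e : ℕ} (C : ℤ) :
    eisComb k m e (fun N => (C.gcd N / N : ℂ) ^ (2 * k))
      = (((-3) ^ m - 1 + (3 ^ (2 * k) - (-3) ^ m) * (C.gcd 3 / 3 : ℂ) ^ (2 * k))
          / (3 ^ (2 * k) - 1))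
        * (((-1) ^ e - (1 + (-1) ^ e) * (C.gcd 2 / 2 : ℂ) ^ (2 * k)
          + 2 ^ (2 * k) * (C.gcd 4 / 4 : ℂ) ^ (2 * k)) / (2 ^ (2 * k) - 1)) := by
  have h6 : C.gcd 6 = C.gcd 3 * C.gcd 2 :=
    Nat.Coprime.gcd_mul C.natAbs (show Nat.Coprime 3 2 by decide)
  have h12 : C.gcd 12 = C.gcd 3 * C.gcd 4 :=
    Nat.Coprime.gcd_mul C.natAbs (show Nat.Coprime 3 4 by decide)
  rw [eisComb_of_mul]
  · norm_cast
  · simp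
  · simp only [Nat.cast_ofNat, h6, ← mul_pow]
    push_cast
    ring_nf
  · simp only [Nat.cast_ofNat, h12, ← mul_pow]
    push_cast
    ring_nf

theorem pow_two_mul_sub_one_ne_zero {k : ℕ} (hk : 1 ≤ k) {x : ℝ} (hx : 1 < x) :
    ((x : ℂ) ^ (2 * k) - 1) ≠ 0 := by
  have := one_lt_pow₀ hx (show 2 * k ≠ 0 by omega)
  rw [sub_ne_zero]
  exact_mod_cast this.ne'

theorem thetaForm_one_zero_left (d : ZMod 4) : thetaForm 0 d 1 0 = (ZMod.χ₄ d : ℤ) := by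
  rw [thetaForm_zero_left, one_pow, mul_one]

theorem pow_mul_pow_eq_of_sq {k m l : ℕ} (h : m + l = 2 * k) (x : ℂ) :
    x ^ m * x ^ l = (x ^ 2) ^ k := by
  rw [← pow_add, h, pow_mul]

theorem neg_one_pow_eq_of_add {k m l : ℕ} (h : m + l = 2 * k) : (-1 : ℂ) ^ m = (-1) ^ l := by
  have h1 := pow_mul_pow_eq_of_sq h (-1 : ℂ)
  rw [neg_one_sq, one_pow] at h1
  have h2 : ((-1 : ℂ) ^ l) * (-1) ^ l = 1 := by rw [← mul_pow]; norm_num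
  calc (-1 : ℂ) ^ m = ((-1) ^ m * (-1) ^ l) * (-1) ^ l := by rw [mul_assoc, h2, mul_one]
    _ = (-1) ^ l := by rw [h1, one_mul]

theorem three_factor {k m l : ℕ} (hk : 1 ≤ k) (h : m + l = 2 * k) {g n : ℕ} {s : ℂ}
    (hg : g = 3 ∧ n = 1 ∧ s = 1 ∨ g = 1 ∧ n = 3 ∧ s = -1) :
    ((-3) ^ m - 1 + (3 ^ (2 * k) - (-3) ^ m) * (g / 3 : ℂ) ^ (2 * k)) / (3 ^ (2 * k) - 1)
      = (s / n) ^ l := by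
  have h3 : (3 ^ (2 * k) - 1 : ℂ) ≠ 0 := by
    exact_mod_cast pow_two_mul_sub_one_ne_zero hk (x := 3) (by norm_num)
  rw [div_eq_iff h3]
  obtain ⟨rfl, rfl, rfl⟩ | ⟨rfl, rfl, rfl⟩ := hg
  · norm_num
  · have e : (-3 : ℂ) ^ m = (-1) ^ l * 3 ^ m := by
      rw [← neg_one_pow_eq_of_add h, ← mul_pow]; norm_num
    rw [e, ← h, pow_add, div_pow, div_pow]
    push_cast
    field_simp
    ring

theorem thetaForm_one_zero_of_odd {c : ZMod 4} (hc : c = 1 ∨ c = 3) (d : ZMod 4) :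
    thetaForm c d 1 0 = (ZMod.χ₄ c : ℤ) * (-I / 2) := by
  obtain rfl | rfl := hc
  · rw [thetaForm_one_left]
    simp
  · rw [thetaForm_three_left, show ZMod.χ₄ 3 = -1 from rfl]
    push_cast
    ring

theorem Int.emod_four_cast_eq (C : ℤ) : ((C % 4 : ℤ) : ZMod 4) = C :=
  (ZMod.intCast_eq_intCast_iff _ _ 4).2 (Int.mod_modEq C 4)

/-- The value at `i∞` of the theta product transformed by a matrix with bottom row `(C, D)`. -/
theorem thetaForm_pow_mul_thetaForm_pow {k m l : ℕ} (hk : 1 ≤ k) (h : m + l = 2 * k)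
    {A B C D c n w t : ℤ} (hdet : A * D - B * C = 1) (hn : 3 = C.gcd 3 * n)
    (hC : C = C.gcd 3 * c) (hD : c * t + w * n = D) :
    thetaForm C D 1 0 ^ m * (thetaForm c w 1 0 / n) ^ l
      = eisComb k m (k + l) (fun N => (C.gcd N / N : ℂ) ^ (2 * k)) := by
  have h2 : (2 ^ (2 * k) - 1 : ℂ) ≠ 0 := by
    exact_mod_cast pow_two_mul_sub_one_ne_zero hk (x := 2) (by norm_num)
  obtain ⟨s, n', rfl, hs⟩ : ∃ (s : ℤ) (n' : ℕ), n = n' ∧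
      (C.gcd 3 = 3 ∧ n' = 1 ∧ s = 1 ∨ C.gcd 3 = 1 ∧ n' = 3 ∧ s = -1) := by
    have hdvd : C.gcd 3 ∣ 3 := by exact_mod_cast Dvd.intro _ hn.symm
    obtain h1 | h1 := (Nat.dvd_prime Nat.prime_three).1 hdvd
    · exact ⟨-1, 3, by rw [h1] at hn; push_cast at hn; omega, Or.inr ⟨h1, rfl, rfl⟩⟩
    · exact ⟨1, 1, by rw [h1] at hn; push_cast at hn; omega, Or.inl ⟨h1, rfl, rfl⟩⟩
  have hss : (s : ℂ) ^ l * s ^ l = 1 := by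
    rw [← mul_pow]
    obtain ⟨-, -, rfl⟩ | ⟨-, -, rfl⟩ := hs <;> norm_num
  have h4 : (4 : ZMod 4) = 0 := rfl
  have hc4 : (c : ZMod 4) = -(s * C) := by
    obtain ⟨h1, -, rfl⟩ | ⟨h1, -, rfl⟩ := hs <;> rw [h1] at hC <;> rw [hC] <;> push_cast
    · linear_combination (c : ZMod 4) * h4
    · ring
  have hw4 (hC0 : (C : ZMod 4) = 0) : (w : ZMod 4) = s * D := by
    have hc0 : (c : ZMod 4) = 0 := by rw [hc4, hC0, mul_zero, neg_zero]
    rw [← hD]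
    obtain ⟨-, rfl, rfl⟩ | ⟨-, rfl, rfl⟩ := hs <;> push_cast <;> rw [hc0]
    · ring
    · linear_combination (w : ZMod 4) * h4
  have hs' : C.gcd 3 = 3 ∧ n' = 1 ∧ (s : ℂ) = 1 ∨ C.gcd 3 = 1 ∧ n' = 3 ∧ (s : ℂ) = -1 := by
    exact_mod_cast hs
  rw [eisComb_gcd, three_factor hk h hs', div_pow, div_pow, Int.cast_natCast]
  suffices key : thetaForm C D 1 0 ^ m * thetaForm c w 1 0 ^ l * s ^ l
      = (((-1) ^ (k + l) - (1 + (-1) ^ (k + l)) * (C.gcd 2 / 2 : ℂ) ^ (2 * k)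
          + 2 ^ (2 * k) * (C.gcd 4 / 4 : ℂ) ^ (2 * k)) / (2 ^ (2 * k) - 1)) by
    rw [← key]
    linear_combination -thetaForm C D 1 0 ^ m * thetaForm c w 1 0 ^ l / n' ^ l * hss
  rw [eq_div_iff h2, ← Int.gcd_emod C 4, ← Int.gcd_emod C 2,
    ← Int.emod_emod_of_dvd C (show (2 : ℤ) ∣ 4 by decide)]
  have hodd (hC1 : (C : ZMod 4) = 1 ∨ (C : ZMod 4) = 3) :
      thetaForm C D 1 0 ^ m * thetaForm c w 1 0 ^ l * s ^ l = (-1) ^ (k + l) / 2 ^ (2 * k) := by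
    have hχ : ZMod.χ₄ (c : ZMod 4) = -(s * ZMod.χ₄ (C : ZMod 4)) := by
      rw [hc4]
      obtain ⟨-, -, rfl⟩ | ⟨-, -, rfl⟩ := hs <;> obtain hC1 | hC1 := hC1 <;> rw [hC1] <;> rfl
    have hC2 : ((ZMod.χ₄ (C : ZMod 4) : ℤ) : ℂ) ^ 2 = 1 := by
      obtain hC1 | hC1 := hC1 <;> rw [hC1]
      · simp
      · rw [show ZMod.χ₄ 3 = -1 from rfl]; norm_num
    have hc1 : (c : ZMod 4) = 1 ∨ (c : ZMod 4) = 3 := by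
      rw [hc4]
      obtain ⟨-, -, rfl⟩ | ⟨-, -, rfl⟩ := hs <;> obtain hC1 | hC1 := hC1 <;> rw [hC1] <;> decide
    rw [thetaForm_one_zero_of_odd hC1, thetaForm_one_zero_of_odd hc1, hχ]
    push_cast
    set x : ℂ := (ZMod.χ₄ (C : ZMod 4) : ℤ) * (-I / 2) with hx
    have hx2 : x ^ 2 = -1 / 2 ^ 2 := by
      rw [hx, mul_pow, hC2, div_pow, neg_sq, I_sq, one_mul]
    have e := pow_mul_pow_eq_of_sq h x
    rw [hx2, div_pow, ← pow_mul] at e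
    calc x ^ m * (-((s : ℂ) * (ZMod.χ₄ (C : ZMod 4) : ℤ)) * (-I / 2)) ^ l * s ^ l
        = x ^ m * ((-1) * s * x) ^ l * s ^ l := by rw [hx]; ring
      _ = (-1) ^ l * (x ^ m * x ^ l) * (s ^ l * s ^ l) := by rw [mul_pow, mul_pow]; ring
      _ = _ := by rw [e, hss]; ring
  have hquarter : (1 / 4 : ℂ) ^ (2 * k) = 1 / (2 ^ (2 * k) * 2 ^ (2 * k)) := by
    rw [← mul_pow, one_div_pow]; norm_num
  have hcast := Int.emod_four_cast_eq C
  have hcases : C % 4 = 0 ∨ C % 4 = 1 ∨ C % 4 = 2 ∨ C % 4 = 3 := by omega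
  obtain h0 | h0 | h0 | h0 := hcases <;> rw [h0] at hcast ⊢
  · have hC0 : (C : ZMod 4) = 0 := by rw [← hcast]; rfl
    have hAD : (A * D : ZMod 4) = 1 := by
      have := congrArg (Int.cast : ℤ → ZMod 4) hdet
      push_cast at this
      rwa [hC0, mul_zero, sub_zero] at this
    have hD2 : (ZMod.χ₄ (D : ZMod 4)) ^ 2 = 1 := by
      generalize (A : ZMod 4) = x, (D : ZMod 4) = y at hAD
      decide +revert
    have hχ : ZMod.χ₄ (w : ZMod 4) = s * ZMod.χ₄ (D : ZMod 4) := by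
      rw [hw4 hC0]
      obtain ⟨-, -, rfl⟩ | ⟨-, -, rfl⟩ := hs
      · simp
      · rw [map_mul]; rfl
    rw [hc4, hC0, mul_zero, neg_zero, thetaForm_one_zero_left, thetaForm_one_zero_left, hχ]
    have e := pow_mul_pow_eq_of_sq h ((ZMod.χ₄ (D : ZMod 4) : ℤ) : ℂ)
    rw [show (((ZMod.χ₄ (D : ZMod 4) : ℤ) : ℂ)) ^ 2 = 1 by exact_mod_cast hD2, one_pow] at e
    push_cast
    rw [mul_pow, show ∀ x y z : ℂ, x * (y * z) * y = x * z * (y * y) by intros; ring, e, hss]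
    norm_num
    ring
  · rw [hodd (Or.inl (by rw [← hcast]; rfl)), show ((1 : ℤ) % 2).gcd 2 = 1 by decide,
      show (1 : ℤ).gcd 4 = 1 by decide, Nat.cast_one, hquarter, one_div_pow]
    field_simp
    ring
  · have hC2 : (C : ZMod 4) = 2 := by rw [← hcast]; rfl
    have hc2 : (c : ZMod 4) = 2 := by
      rw [hc4, hC2]
      obtain ⟨-, -, rfl⟩ | ⟨-, -, rfl⟩ := hs <;> rfl
    rw [hC2, hc2, thetaForm_two_left, thetaForm_two_left, show ((2 : ℤ) % 2).gcd 2 = 2 by decide,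
      show (2 : ℤ).gcd 4 = 2 by decide]
    have hml : m ≠ 0 ∨ l ≠ 0 := by omega
    have e : (2 : ℂ) ^ (2 * k) * (2 / 4) ^ (2 * k) = 1 := by rw [← mul_pow]; norm_num
    rw [Nat.cast_ofNat, e]
    obtain hm | hl := hml
    · simp [hm]
    · simp [hl]
  · rw [hodd (Or.inr (by rw [← hcast]; rfl)), show ((3 : ℤ) % 2).gcd 2 = 1 by decide,
      show (3 : ℤ).gcd 4 = 1 by decide, Nat.cast_one, hquarter, one_div_pow]
    field_simp
    ring

theorem phi_add_intCast (z : ℂ) (t : ℤ) : phi (z + t) = phi z := by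
  have h : Function.Periodic phi 1 := phi_add_one
  simpa using h.int_mul t z

theorem E2k_add_one (k : ℕ) (z : ℂ) : E2k k (z + 1) = E2k k z := by
  unfold E2k
  congr 2
  refine tsum_congr fun n => ?_
  rw [show 2 * Real.pi * I * (n + 1) * (z + 1)
    = 2 * Real.pi * I * (n + 1) * z + (n + 1 : ℤ) * (2 * Real.pi * I) by push_cast; ring,
    exp_add, exp_int_mul_two_pi_mul_I, mul_one]

theorem E2k_add_intCast (k : ℕ) (z : ℂ) (t : ℤ) : E2k k (z + t) = E2k k z := by
  have h : Function.Periodic (E2k k) 1 := E2k_add_one k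
  simpa using h.int_mul t z

/-- The difference of the theta product `phi ^ (2 * m) * phi (3 * ·) ^ (2 * l)` and its Eisenstein
part. -/
noncomputable def cuspPart (k m l : ℕ) (z : UpperHalfPlane) : ℂ :=
  (phi z ^ 2) ^ m * (phi (3 * z) ^ 2) ^ l
    - eisComb k m (k + l) (fun N => E2k k (N * z))

theorem slOfDet_apply (γ : SL(2, ℤ)) :
    ∃ h : γ 0 0 * γ 1 1 - γ 0 1 * γ 1 0 = 1,
      slOfDet (γ 0 0) (γ 0 1) (γ 1 0) (γ 1 1) h = γ := by
  refine ⟨by rw [← Matrix.det_fin_two]; exact γ.det_coe, ?_⟩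
  ext i j
  fin_cases i <;> fin_cases j <;> rfl

theorem cuspPart_slash {k m l : ℕ} (hml : m + l = 2 * k) {A B C D : ℤ}
    (h : A * D - B * C = 1) (z : UpperHalfPlane) :
    (cuspPart k m l ∣[(2 * k : ℤ)] slOfDet A B C D h) z
      = (phi ((A * z + B) / (C * z + D)) ^ 2 / (C * z + D)) ^ m
          * (phi (3 * ((A * z + B) / (C * z + D))) ^ 2 / (C * z + D)) ^ l
        - eisComb k m (k + l)
          (fun N => E2k k (N * ((A * z + B) / (C * z + D))) / (C * z + D) ^ (2 * k)) := by
  have hd := moebius_denom_ne_zero h z.im_pos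
  rw [ModularForm.SL_slash_apply, denom_slOfDet, cuspPart, coe_slOfDet_smul, eisComb_div, div_pow,
    div_pow, div_mul_div_comm, ← pow_add, hml, zpow_neg,
    show (2 * k : ℤ) = ((2 * k : ℕ) : ℤ) by push_cast; rfl, zpow_natCast]
  field_simp

theorem isZeroAtImInfty_cuspPart_slash {k m l : ℕ} (hk : 1 ≤ k) (hml : m + l = 2 * k)
    (γ : SL(2, ℤ)) :
    UpperHalfPlane.IsZeroAtImInfty (cuspPart k m l ∣[(2 * k : ℤ)] γ) := by
  obtain ⟨h, hγ⟩ := slOfDet_apply γ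
  rw [← hγ]
  generalize γ 0 0 = A, γ 0 1 = B, γ 1 0 = C, γ 1 1 = D at h
  obtain ⟨c, n, w, t, hn, hNn, hC, hD, hdet⟩ := exists_hecke_factor (N := 3) (by decide) h
  have hg : 0 < (C.gcd (3 : ℕ) : ℤ) := by
    exact_mod_cast Int.gcd_pos_of_ne_zero_right C (by decide)
  have h1 := tendsto_phi_sq_mul_moebius (N := 1) (g := 1) (n := 1) (c := C) (w := D) (t := 0) h
    one_pos one_pos (by decide) (by ring) (by ring) (by linear_combination h)
  have h3 := tendsto_phi_sq_mul_moebius h hg hn hNn hC hD hdet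
  have hE := tendsto_eisComb (k := k) (m := m) (e := k + l)
    fun N hN => tendsto_E2k_mul_moebius hk hN h
  have hlim := ((h1.pow m).mul (h3.pow l)).sub hE
  rw [Int.cast_one, div_one, thetaForm_pow_mul_thetaForm_pow hk hml h hNn hC hD, sub_self] at hlim
  refine (hlim.comp UpperHalfPlane.tendsto_coe_atImInfty).congr fun z => ?_
  rw [cuspPart_slash hml]
  simp

theorem cuspPart_slash_of_dvd {k m l : ℕ} (hk : 1 ≤ k) (hml : m + l = 2 * k) {A B C D : ℤ}
    (h : A * D - B * C = 1) (hC : 12 ∣ C) :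
    cuspPart k m l ∣[(2 * k : ℤ)] slOfDet A B C D h = cuspPart k m l := by
  ext z
  have hd := moebius_denom_ne_zero h z.im_pos
  have hgcd {N : ℕ} (hN : N ∣ 12) : C.gcd N = N :=
    by exact_mod_cast Int.gcd_eq_right (by positivity) ((Int.natCast_dvd_natCast.2 hN).trans hC)
  rw [cuspPart_slash hml, cuspPart]
  congr 1
  · obtain ⟨c, n, w, t, hn, hNn, hCc, hD, hdet⟩ := exists_hecke_factor (N := 3) (by decide) h
    rw [hgcd (by decide)] at hNn hCc hdet
    obtain rfl : n = 1 := by push_cast at hNn; omega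
    have h1 := phi_sq_moebius h z.im_pos
    have h3 := phi_sq_mul_moebius (by decide) hn hNn hCc hD hdet z.im_pos
    have hC4 : (C : ZMod 4) = 0 :=
      (ZMod.intCast_zmod_eq_zero_iff_dvd C 4).2 ((by decide : (4 : ℤ) ∣ 12).trans hC)
    have hc4 : (c : ZMod 4) = 0 := by
      refine (ZMod.intCast_zmod_eq_zero_iff_dvd c 4).2 ?_
      push_cast at hCc ⊢
      omega
    have hw : (w : ZMod 4) = D := by
      rw [← hD]; push_cast; rw [hc4]; ring
    have hAD : (A * D : ZMod 4) = 1 := by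
      have := congrArg (Int.cast : ℤ → ZMod 4) h
      push_cast at this
      rwa [hC4, mul_zero, sub_zero] at this
    have hD2 : (ZMod.χ₄ (D : ZMod 4)) ^ 2 = 1 := by
      generalize (A : ZMod 4) = x, (D : ZMod 4) = y at hAD
      decide +revert
    have e := pow_mul_pow_eq_of_sq hml ((ZMod.χ₄ (D : ZMod 4) : ℤ) : ℂ)
    rw [show (((ZMod.χ₄ (D : ZMod 4) : ℤ) : ℂ)) ^ 2 = 1 by exact_mod_cast hD2, one_pow] at e
    rw [hC4, thetaForm_zero_left] at h1
    rw [hc4, hw, thetaForm_zero_left] at h3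
    push_cast at h3
    rw [div_one, div_one, div_one, phi_add_intCast] at h3
    rw [h1, h3, mul_div_cancel_left₀ _ hd, mul_div_cancel_left₀ _ hd, mul_pow, mul_pow]
    linear_combination (phi z ^ 2) ^ m * (phi (3 * z) ^ 2) ^ l * e
  · obtain ⟨κ, hκ, H⟩ := exists_E2k_mul_moebius hk
    have hE : ∀ N : ℕ, 0 < N → N ∣ 12 →
        E2k k (N * ((A * z + B) / (C * z + D))) / (C * z + D) ^ (2 * k)
          = 1 * E2k k (N * z) + κ * C * (C * z + D) / (C * z + D) ^ (2 * k) * (N : ℂ)⁻¹ := by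
      intro N hN hN12
      obtain ⟨n, t, hn, hNn, hE⟩ := H hN h
      rw [hgcd hN12] at hNn hE
      obtain rfl : n = 1 := by
        have hN0 : (N : ℤ) ≠ 0 := by exact_mod_cast hN.ne'
        exact mul_left_cancel₀ hN0 (by rw [← hNn, mul_one])
      rw [hE z.im_pos, add_div, mul_div_cancel_left₀ _ (pow_ne_zero _ hd)]
      push_cast
      rw [div_one, div_one, E2k_add_intCast]
      ring
    rw [eisComb_congr hE, eisComb_mul_add_mul, one_mul]
    by_cases hk1 : k = 1
    · subst hk1
      rw [eisComb_inv hml, mul_zero, add_zero]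
    · simp [hκ hk1]

theorem mdifferentiable_cuspPart {k m l : ℕ} (hk : 1 ≤ k) : MDiff (cuspPart k m l) := by
  rw [UpperHalfPlane.mdifferentiable_iff]
  have hphi {r : ℝ} (hr : 0 < r) :
      DifferentiableOn ℂ (fun z : ℂ => phi (r * z)) {z | 0 < z.im} := by
    intro z hz
    simp only [phi_eq_jacobiTheta]
    refine DifferentiableAt.differentiableWithinAt ?_
    refine DifferentiableAt.comp (g := jacobiTheta) (f := fun z : ℂ => 2 * ((r : ℂ) * z)) z ?_
      (by fun_prop)
    exact differentiableAt_jacobiTheta (by simpa [hr] using hz)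
  have hE0 := UpperHalfPlane.mdifferentiable_iff.1 (mdifferentiable_E2k hk)
  have hE {N : ℕ} (hN : 0 < N) :
      DifferentiableOn ℂ (fun z : ℂ => E2k k (N * z)) {z | 0 < z.im} := by
    have hN' : (0 : ℝ) < N := by exact_mod_cast hN
    have hE1 : DifferentiableOn ℂ (E2k k) {z | 0 < z.im} :=
      hE0.congr fun z hz => by simp [UpperHalfPlane.ofComplex_apply_of_im_pos hz]
    refine hE1.comp (f := fun z : ℂ => N * z) (by fun_prop) fun z hz => ?_
    simpa [hN'] using hz
  have h1 := hphi one_pos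
  have h3 := hphi three_pos
  push_cast at h1 h3
  simp only [one_mul] at h1
  have hf : DifferentiableOn ℂ (fun z : ℂ => (phi z ^ 2) ^ m * (phi (3 * z) ^ 2) ^ l
      - eisComb k m (k + l) (fun N => E2k k (N * z))) {z | 0 < z.im} := by
    refine (((h1.pow 2).pow m).mul ((h3.pow 2).pow l)).sub ?_
    unfold eisComb
    have e1 := hE (N := 1) (by decide)
    have e2 := hE (N := 2) (by decide)
    have e3 := hE (N := 3) (by decide)
    have e4 := hE (N := 4) (by decide)
    have e6 := hE (N := 6) (by decide)
    have e12 := hE (N := 12) (by decide)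
    exact (((e1.const_mul _).add (e3.const_mul _)).const_mul _ |>.add
      (((e2.const_mul _).add (e6.const_mul _)).const_mul _)).add
      (((e4.const_mul _).add (e12.const_mul _)).const_mul _)
  exact hf.congr fun z hz => by
    simp [cuspPart, UpperHalfPlane.ofComplex_apply_of_im_pos hz]

/-- `cuspPart` as a cusp form. -/
noncomputable def cuspPartForm {k m l : ℕ} (hk : 1 ≤ k) (hml : m + l = 2 * k) :
    CuspForm (CongruenceSubgroup.Gamma0 12) (2 * k) where
  toFun := cuspPart k m l
  slash_action_eq' := by
    rintro _ ⟨γ, hγ, rfl⟩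
    obtain ⟨h, hγ'⟩ := slOfDet_apply γ
    have hC : (12 : ℤ) ∣ γ 1 0 := by
      exact_mod_cast (ZMod.intCast_zmod_eq_zero_iff_dvd _ 12).1 (CongruenceSubgroup.Gamma0_mem.1 hγ)
    have := cuspPart_slash_of_dvd hk hml h hC
    rw [hγ'] at this
    exact this
  holo' := mdifferentiable_cuspPart hk
  zero_at_cusps' := by
    intro c hc
    rw [Subgroup.IsArithmetic.isCusp_iff_isCusp_SL2Z] at hc
    rw [OnePoint.isZeroAt_iff_forall_SL2Z hc]
    exact fun γ _ => isZeroAtImInfty_cuspPart_slash hk hml γ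

theorem stmt_11 (a b k : ℕ) (ha : Even a) (hb : Even b) (hk : 1 ≤ k)
    (hab : a + b = 4 * k) :
    ∃ C : CuspForm (CongruenceSubgroup.Gamma0 12) (2 * k),
      ∀ z : UpperHalfPlane,
        phi (z : ℂ) ^ a * phi (3 * (z : ℂ)) ^ b =
          ((-1 : ℂ) ^ ((a + 3 * b) / 4) / ((2 ^ (2 * k) - 1) * (3 ^ (2 * k) - 1))) *
            (((-3 : ℂ) ^ (a / 2) - 1) * E2k k (z : ℂ) +
              ((3 : ℂ) ^ (2 * k) - (-3 : ℂ) ^ (a / 2)) * E2k k (3 * (z : ℂ))) +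
          (-(1 + (-1 : ℂ) ^ ((a + 3 * b) / 4)) / ((2 ^ (2 * k) - 1) * (3 ^ (2 * k) - 1))) *
            (((-3 : ℂ) ^ (a / 2) - 1) * E2k k (2 * (z : ℂ)) +
              ((3 : ℂ) ^ (2 * k) - (-3 : ℂ) ^ (a / 2)) * E2k k (6 * (z : ℂ))) +
          ((2 : ℂ) ^ (2 * k) / ((2 ^ (2 * k) - 1) * (3 ^ (2 * k) - 1))) *
            (((-3 : ℂ) ^ (a / 2) - 1) * E2k k (4 * (z : ℂ)) +
              ((3 : ℂ) ^ (2 * k) - (-3 : ℂ) ^ (a / 2)) * E2k k (12 * (z : ℂ))) +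
          C z := by
  obtain ⟨m, rfl⟩ := even_iff_exists_two_mul.1 ha
  obtain ⟨l, rfl⟩ := even_iff_exists_two_mul.1 hb
  have hml : m + l = 2 * k := by omega
  refine ⟨cuspPartForm hk hml, fun z => ?_⟩
  have hm : 2 * m / 2 = m := by omega
  have he : (2 * m + 3 * (2 * l)) / 4 = k + l := by omega
  rw [hm, he, pow_mul, pow_mul]
  change _ = _ + ((phi z ^ 2) ^ m * (phi (3 * z) ^ 2) ^ l
    - eisComb k m (k + l) (fun N => E2k k (N * z)))
  unfold eisComb
  push_cast
  rw [one_mul]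
  ring
end
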